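/- Let f : [0,1] → ℂ be continuous and suppose there exists p > 0 such that |f(t)| = O(t^p) and |f(1−t)| = O(t^p) as t → 0⁺. Then the function x ↦ f(er(x)) is integrable on ℝ, so the integral I(f) = ∫_{-∞}^{∞} f(er(x)) dx converges. -/

import Mathlib

open MeasureTheory Real Filter Asymptotics

theorem integrable_exp_neg_sq : Integrable fun t : ℝ => Real.exp (-t ^ 2) := by
  simpa using integrable_exp_neg_mul_sq one_pos

theorem setIntegral_exp_neg_sq_Iic_pos (x : ℝ) : 0 < ∫ t in Set.Iic x, Real.exp (-t ^ 2) := by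
  rw [setIntegral_pos_iff_support_of_nonneg_ae (Eventually.of_forall fun t => (exp_pos _).le)
    integrable_exp_neg_sq.integrableOn]
  have : Function.support (fun t : ℝ => Real.exp (-t ^ 2)) = Set.univ := by
    ext t; simp [(exp_pos _).ne']
  simp [this]

theorem setIntegral_exp_neg_sq_Iic_le (x : ℝ) :
    ∫ t in Set.Iic x, Real.exp (-t ^ 2) ≤ Real.exp 1 * Real.exp x := by
  rw [← integral_exp_Iic x, ← integral_const_mul]
  refine setIntegral_mono integrable_exp_neg_sq.integrableOn
    ((integrableOn_exp_Iic x).const_mul _) fun t => ?_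
  simp only [← Real.exp_add]
  exact Real.exp_le_exp.2 (by nlinarith [sq_nonneg (t + 1 / 2)])

theorem setIntegral_exp_neg_sq_Iic_neg (x : ℝ) :
    ∫ t in Set.Iic (-x), Real.exp (-t ^ 2) = √π - ∫ t in Set.Iic x, Real.exp (-t ^ 2) := by
  have htotal : ∫ t : ℝ, Real.exp (-t ^ 2) = √π := by simpa using integral_gaussian 1
  have hsplit := intervalIntegral.integral_Iic_add_Ioi
    (integrable_exp_neg_sq.integrableOn (s := Set.Iic x)) integrable_exp_neg_sq.integrableOn
  have hreflect := integral_comp_neg_Iic (-x) fun t => Real.exp (-t ^ 2)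
  simp only [neg_sq, neg_neg] at hreflect
  linarith

theorem continuous_setIntegral_exp_neg_sq_Iic :
    Continuous fun x : ℝ => ∫ t in Set.Iic x, Real.exp (-t ^ 2) := by
  have heq : (fun x : ℝ => ∫ t in Set.Iic x, Real.exp (-t ^ 2)) = fun x =>
      (∫ t in Set.Iic 0, Real.exp (-t ^ 2)) + ∫ t in (0 : ℝ)..x, Real.exp (-t ^ 2) := by
    funext x
    rw [← intervalIntegral.integral_Iic_sub_Iic integrable_exp_neg_sq.integrableOn
      integrable_exp_neg_sq.integrableOn]
    ring
  rw [heq]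
  exact continuous_const.add (intervalIntegral.continuous_primitive
    (fun _ _ => integrable_exp_neg_sq.intervalIntegrable) 0)

/-- If `f : [0,1] → ℂ` is continuous with `f(t) = O(t^p)` and
`f(1-t) = O(t^p)` as `t → 0⁺` for some `p > 0`, then `x ↦ f(er(x))` is integrable
on `ℝ`, i.e. `I(f) = ∫_ℝ f(er(x)) dx` converges. -/
theorem integrability_of_f_comp_er
    (er : ℝ → ℝ)
    (her : ∀ x : ℝ, er x = (Real.sqrt π)⁻¹ * ∫ t in Set.Iic x, Real.exp (-t ^ 2))
    (f : ℝ → ℂ) (hf : ContinuousOn f (Set.Icc 0 1))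
    (p : ℝ) (hp : 0 < p)
    (h0 : f =O[nhdsWithin 0 (Set.Ioi 0)] fun t : ℝ => t ^ p)
    (h1 : (fun t : ℝ => f (1 - t)) =O[nhdsWithin 0 (Set.Ioi 0)] fun t : ℝ => t ^ p) :
    Integrable (fun x : ℝ => f (er x)) := by
  have hsqrt : 0 < √π := Real.sqrt_pos.2 pi_pos
  have hpos (x : ℝ) : 0 < er x := by
    rw [her]; exact mul_pos (inv_pos.2 hsqrt) (setIntegral_exp_neg_sq_Iic_pos x)
  have hreflect (x : ℝ) : er x = 1 - er (-x) := by
    rw [her, her, setIntegral_exp_neg_sq_Iic_neg]; field_simp; ring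
  have hcont : Continuous er := by
    rw [funext her]; exact continuous_const.mul continuous_setIntegral_exp_neg_sq_Iic
  set C : ℝ := (√π)⁻¹ * Real.exp 1 with hC
  have hle (x : ℝ) : er x ≤ C * Real.exp x := by
    rw [her, hC, mul_assoc]
    exact mul_le_mul_of_nonneg_left (setIntegral_exp_neg_sq_Iic_le x) (inv_pos.2 hsqrt).le
  have hlim : Tendsto er atBot (nhdsWithin 0 (Set.Ioi 0)) := by
    refine tendsto_nhdsWithin_iff.2 ⟨?_, Eventually.of_forall hpos⟩
    refine squeeze_zero (fun x => (hpos x).le) hle ?_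
    simpa using tendsto_exp_atBot.const_mul C
  have hbound : (fun x => er x ^ p) =O[atBot] fun x => Real.exp (p * x) := by
    refine IsBigO.of_bound (C ^ p) (Eventually.of_forall fun x => ?_)
    have hCpos : 0 ≤ C := by positivity
    rw [Real.norm_of_nonneg (rpow_nonneg (hpos x).le p), Real.norm_of_nonneg (exp_pos _).le,
      mul_comm p, Real.exp_mul, ← Real.mul_rpow hCpos (exp_pos _).le]
    exact Real.rpow_le_rpow (hpos x).le (hle x) hp.le
  have hcomp : Continuous fun x => f (er x) :=
    hf.comp_continuous hcont fun x => ⟨(hpos x).le, by linarith [hreflect x, hpos (-x)]⟩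
  have hbot : (fun x => f (er x)) =O[atBot] fun x => Real.exp (p * x) :=
    (h0.comp_tendsto hlim).trans hbound
  have htop : (fun x => f (er x)) =O[atTop] fun x => Real.exp (-p * x) := by
    have h := ((h1.comp_tendsto hlim).trans hbound).comp_tendsto tendsto_neg_atTop_atBot
    refine h.congr (fun x => ?_) fun x => ?_
    · simp [hreflect x]
    · simp
  exact hcomp.locallyIntegrable.integrable_of_isBigO_atBot_atTop hbot
    ⟨Set.Iic 0, Iic_mem_atBot 0, integrableOn_exp_mul_Iic hp 0⟩ htop
    ⟨Set.Ioi 0, Ioi_mem_atTop 0, exp_neg_integrableOn_Ioi 0 hp⟩
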